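/- Suppose Σ_C contains a concept name A and Σ_R contains a role name R. Then the concept A has no finite characterisation w.r.t. L(≥,⊔)[Σ_C,Σ_R]; in particular, L(≥,⊔) does not admit finite characterisations. -/

import Mathlib

namespace DL

/-! ### Syntax of ALCQI concepts -/

/-- Roles: role names (indexed by ℕ) and inverse roles. -/
inductive Role where
  | name : ℕ → Role
  | inv  : ℕ → Role
deriving DecidableEq

/-- ALCQI concept expressions. -/
inductive Concept where
  | atom : ℕ → Concept
  | top  : Concept
  | bot  : Concept
  | and  : Concept → Concept → Concept
  | or   : Concept → Concept → Concept
  | neg  : Concept → Concept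
  | ex   : Role → Concept → Concept
  | all  : Role → Concept → Concept
  | atLeast : ℕ → Role → Concept → Concept
deriving DecidableEq

/-- The operators/constructors that a concept language may use. -/
inductive Op where
  | all | ex | ge | inv | and | or | top | bot | neg
deriving DecidableEq

/-! ### Interpretations and semantics -/

/-- An interpretation: a nonempty domain, interpretations of concept names
and of role names. -/
structure Interp where
  Δ : Type
  dom_nonempty : Nonempty Δ
  atom : ℕ → Set Δ
  rel : ℕ → Δ → Δ → Prop

def Role.sem (I : Interp) : Role → (I.Δ → I.Δ → Prop)
  | .name R => I.rel R
  | .inv R  => fun d e => I.rel R e d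

def Concept.sem (I : Interp) : Concept → Set I.Δ
  | .atom A => I.atom A
  | .top => Set.univ
  | .bot => ∅
  | .and C D => C.sem I ∩ D.sem I
  | .or C D => C.sem I ∪ D.sem I
  | .neg C => (C.sem I)ᶜ
  | .ex S C => {d | ∃ e, S.sem I d e ∧ e ∈ C.sem I}
  | .all S C => {d | ∀ e, S.sem I d e → e ∈ C.sem I}
  | .atLeast k S C => {d | ∃ s : Finset I.Δ, s.card = k ∧ ∀ e ∈ s, S.sem I d e ∧ e ∈ C.sem I}

/-! ### Concept languages L(Os)[SC, SR] -/

def Role.inSig (Os : Finset Op) (SR : Finset ℕ) : Role → Prop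
  | .name R => R ∈ SR
  | .inv R  => Op.inv ∈ Os ∧ R ∈ SR

/-- Membership of a concept in the language `L(Os)[SC, SR]`. -/
def Concept.inLang (Os : Finset Op) (SC SR : Finset ℕ) : Concept → Prop
  | .atom A => A ∈ SC
  | .top => Op.top ∈ Os
  | .bot => Op.bot ∈ Os
  | .and C D => Op.and ∈ Os ∧ C.inLang Os SC SR ∧ D.inLang Os SC SR
  | .or C D => Op.or ∈ Os ∧ C.inLang Os SC SR ∧ D.inLang Os SC SR
  | .neg C => Op.neg ∈ Os ∧ C.inLang Os SC SR
  | .ex S C => Op.ex ∈ Os ∧ S.inSig Os SR ∧ C.inLang Os SC SR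
  | .all S C => Op.all ∈ Os ∧ S.inSig Os SR ∧ C.inLang Os SC SR
  | .atLeast k S C => Op.ge ∈ Os ∧ 1 ≤ k ∧ S.inSig Os SR ∧ C.inLang Os SC SR

/-! ### DL-Lite ontologies -/

/-- Basic concepts: concept names, ∃R and ∃R⁻. -/
inductive Basic where
  | atom : ℕ → Basic
  | ex : Role → Basic
deriving DecidableEq

def Basic.sem (I : Interp) : Basic → Set I.Δ
  | .atom A => I.atom A
  | .ex S => {d | ∃ e, S.sem I d e}

/-- A DL-Lite concept inclusion `B ⊑ C` where `C` is a basic concept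
(`negated = false`) or a negated basic concept (`negated = true`). -/
structure CI where
  lhs : Basic
  rhs : Basic
  negated : Bool
deriving DecidableEq

def CI.sat (I : Interp) (ci : CI) : Prop :=
  if ci.negated then ci.lhs.sem I ⊆ (ci.rhs.sem I)ᶜ else ci.lhs.sem I ⊆ ci.rhs.sem I

/-- A DL-Lite ontology: a finite set (list) of concept inclusions. -/
abbrev Ontology := List CI

def Interp.satO (I : Interp) (Ont : Ontology) : Prop := ∀ ci ∈ Ont, ci.sat I

/-! ### Pointed interpretations, examples, characterisations -/

structure PInterp where
  I : Interp
  pt : I.Δ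

/-- A pointed interpretation is finite if its domain is finite. -/
def PInterp.finite (P : PInterp) : Prop := Finite P.I.Δ

/-- `C` fits a collection `(Epos, Eneg)` of labelled examples. -/
def Fits (C : Concept) (Epos Eneg : List PInterp) : Prop :=
  (∀ e ∈ Epos, e.pt ∈ C.sem e.I) ∧ (∀ e ∈ Eneg, e.pt ∉ C.sem e.I)

/-- Equivalence of concepts. -/
def CEquiv (C D : Concept) : Prop := ∀ I : Interp, C.sem I = D.sem I

/-- Equivalence of concepts relative to an ontology. -/
def CEquivO (Ont : Ontology) (C D : Concept) : Prop :=
  ∀ I : Interp, I.satO Ont → C.sem I = D.sem I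

/-- `⊨ C ⊑ D`. -/
def Subsumes (C D : Concept) : Prop := ∀ I : Interp, C.sem I ⊆ D.sem I

/-- `Ont ⊨ C ⊑ D`. -/
def SubsumesO (Ont : Ontology) (C D : Concept) : Prop :=
  ∀ I : Interp, I.satO Ont → C.sem I ⊆ D.sem I

/-- `(Epos, Eneg)` is a finite characterisation of `C` w.r.t. the
concept language (predicate) `L`: all examples are finite, `C` fits,
and every fitting concept of `L` is equivalent to `C`. -/
def FinChar (L : Concept → Prop) (C : Concept) (Epos Eneg : List PInterp) : Prop :=
  (∀ e ∈ Epos ++ Eneg, e.finite) ∧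
  Fits C Epos Eneg ∧
  ∀ D, L D → Fits D Epos Eneg → CEquiv C D

/-- Finite characterisation of `C` w.r.t. `L` under an ontology `Ont`:
all examples are finite and satisfy `Ont`, `C` fits, and every fitting
concept of `L` is equivalent to `C` relative to `Ont`. -/
def FinCharO (Ont : Ontology) (L : Concept → Prop) (C : Concept)
    (Epos Eneg : List PInterp) : Prop :=
  (∀ e ∈ Epos ++ Eneg, e.finite ∧ e.I.satO Ont) ∧
  Fits C Epos Eneg ∧
  ∀ D, L D → Fits D Epos Eneg → CEquivO Ont C D

/-- `L(Os)` admits finite characterisations. -/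
def AdmitsFinChar (Os : Finset Op) : Prop :=
  ∀ SC SR : Finset ℕ, ∀ C : Concept, C.inLang Os SC SR →
    ∃ Epos Eneg : List PInterp, FinChar (Concept.inLang Os SC SR) C Epos Eneg

/-- `L(Os)` admits finite characterisations under the ontology `Ont`. -/
def AdmitsFinCharO (Os : Finset Op) (Ont : Ontology) : Prop :=
  ∀ SC SR : Finset ℕ, ∀ C : Concept, C.inLang Os SC SR →
    ∃ Epos Eneg : List PInterp, FinCharO Ont (Concept.inLang Os SC SR) C Epos Eneg

/-! ### Size, role depth, number restrictions -/

/-- Number of symbols of a concept expression (numbers in binary). -/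
def Concept.size : Concept → ℕ
  | .atom _ => 1
  | .top => 1
  | .bot => 1
  | .and C D => C.size + D.size + 1
  | .or C D => C.size + D.size + 1
  | .neg C => C.size + 1
  | .ex _ C => C.size + 2
  | .all _ C => C.size + 2
  | .atLeast k _ C => C.size + 2 + Nat.size k

/-- Role depth of a concept. -/
def Concept.dp : Concept → ℕ
  | .atom _ => 0
  | .top => 0
  | .bot => 0
  | .and C D => max C.dp D.dp
  | .or C D => max C.dp D.dp
  | .neg C => C.dp
  | .ex _ C => C.dp + 1
  | .all _ C => C.dp + 1
  | .atLeast _ _ C => C.dp + 1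

/-- The largest number occurring in a number restriction of `C` (0 if none). -/
def Concept.nr : Concept → ℕ
  | .atom _ => 0
  | .top => 0
  | .bot => 0
  | .and C D => max C.nr D.nr
  | .or C D => max C.nr D.nr
  | .neg C => C.nr
  | .ex _ C => C.nr
  | .all _ C => C.nr
  | .atLeast k _ C => max k C.nr

/-- A number restriction exceeding the size of a finite domain is unsatisfied there. -/
theorem Concept.notMem_sem_atLeast_of_card_lt {I : Interp} [Finite I.Δ] {k : ℕ}
    (hk : Nat.card I.Δ < k) (S : Role) (C : Concept) (d : I.Δ) :
    d ∉ (Concept.atLeast k S C).sem I := by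
  rintro ⟨s, hs, -⟩
  have := Fintype.ofFinite I.Δ
  have hle := s.card_le_univ
  rw [← Nat.card_eq_fintype_card] at hle
  omega

/-- `A` is not equivalent to `A ⊔ (≥ k R.A)`. -/
theorem not_cEquiv_atom_or_atLeast (A R k : ℕ) :
    ¬ CEquiv (.atom A) (.or (.atom A) (.atLeast k (.name R) (.atom A))) := by
  intro h
  let I : Interp := ⟨ℕ, ⟨0⟩, fun _ => {n | n ≠ 0}, fun _ _ _ => True⟩
  have h0 : (0 : ℕ) ∈ (Concept.atom A).sem I := by
    rw [h I]
    refine Or.inr ⟨Finset.Icc 1 k, Nat.card_Icc 1 k, fun e he => ⟨trivial, ?_⟩⟩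
    exact Nat.one_le_iff_ne_zero.mp (Finset.mem_Icc.mp he).1
  exact h0 rfl

/-- **Theorem**: if `A ∈ SC` and `R ∈ SR`, the concept name `A` has no
finite characterisation w.r.t. `L(≥,⊔)[SC,SR]`; in particular `L(≥,⊔)` does
not admit finite characterisations. -/
theorem no_finchar_ge_or (SC SR : Finset ℕ) (A R : ℕ)
    (hA : A ∈ SC) (hR : R ∈ SR) :
    ¬ ∃ Epos Eneg : List PInterp,
      FinChar (Concept.inLang ({Op.ge, Op.or} : Finset Op) SC SR)
        (Concept.atom A) Epos Eneg := by
  rintro ⟨Epos, Eneg, hfin, ⟨hpos, hneg⟩, huniq⟩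
  let k := (Eneg.map fun e => Nat.card e.I.Δ).sum + 1
  refine not_cEquiv_atom_or_atLeast A R k (huniq _ ?_ ⟨fun e he => Or.inl (hpos e he), ?_⟩)
  · exact ⟨by simp, hA, by simp, Nat.le_add_left 1 _, hR, hA⟩
  · rintro e he (h | h)
    · exact hneg e he h
    · have : Finite e.I.Δ := hfin e (List.mem_append_right _ he)
      have hle : Nat.card e.I.Δ ≤ (Eneg.map fun e => Nat.card e.I.Δ).sum :=
        List.le_sum_of_mem (List.mem_map.mpr ⟨e, he, rfl⟩)
      exact Concept.notMem_sem_atLeast_of_card_lt (Nat.lt_succ_of_le hle) _ _ _ h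

end DL
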